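/- Every antilinear permutation π of ZZ_2^3 has a unique representation of the form π = L ∘ φ, where L is an invertible ZZ_2-linear transformation of ZZ_2^3 and φ is a Fano permutation. -/

import Mathlib

/-- The group `ZZ_2^3`. -/
abbrev V3 := Fin 3 → ZMod 2

/-- A permutation of `ZZ_2^3` is antilinear if it fixes `0` and no three nonzero elements
summing to zero are mapped to three elements summing to zero. -/
def Antilinear (π : Equiv.Perm V3) : Prop :=
  π 0 = 0 ∧ ∀ x y z : V3, x ≠ 0 → y ≠ 0 → z ≠ 0 → x + y + z ≠ 0 ∨ π x + π y + π z ≠ 0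

/-- The standard inner product (dot product mod 2) on `ZZ_2^3`. -/
def dotp (x y : V3) : ZMod 2 := ∑ j, x j * y j

/-- The signature of a permutation of `ZZ_2^3`. -/
def sig (π : Equiv.Perm V3) (x : V3) : V3 :=
  ∑ y ∈ Finset.univ.filter (fun y => dotp x y = 0), π y

/-- A Fano permutation is an antilinear permutation whose signature is the identity. -/
def Fano (π : Equiv.Perm V3) : Prop := Antilinear π ∧ ∀ x, sig π x = x

/-- Identification of `{0,…,7}` with `ZZ_2^3` via binary representation. -/
def ofN (i : Fin 8) : V3 := fun j => if Nat.testBit i.val j.val then 1 else 0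

/-- Identification of `ZZ_2^3` with `{0,…,7}` via binary representation. -/
def toN (x : V3) : Fin 8 :=
  ⟨(x 0).val + 2 * (x 1).val + 4 * (x 2).val, by
    have h0 := ZMod.val_lt (x 0); have h1 := ZMod.val_lt (x 1)
    have h2 := ZMod.val_lt (x 2); omega⟩

/-- The permutation of `ZZ_2^3` described, via the binary identification, by a
table of images of `0,…,7`. -/
noncomputable def permOf (v : Fin 8 → Fin 8) (h : Function.Bijective fun x : V3 => ofN (v (toN x))) :
    Equiv.Perm V3 :=
  Equiv.ofBijective _ h
theorem sum_perm_zero (π : Equiv.Perm V3) : ∑ y, π y = 0 := by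
  rw [Equiv.sum_comp π (fun y => y)]
  decide +kernel

theorem sig_formula (π : Equiv.Perm V3) (x : V3) : sig π x = ∑ y, dotp x y • π y := by
  have h : sig π x = ∑ y, (1 + dotp x y) • π y := by
    unfold sig
    rw [Finset.sum_filter]
    refine Finset.sum_congr rfl fun y _ => ?_
    generalize dotp x y = c
    have hc : c = 0 ∨ c = 1 := by revert c; decide
    rcases hc with rfl | rfl
    · simp
    · have : (1 + 1 : ZMod 2) = 0 := by decide
      simp [this]
  rw [h]
  simp only [add_smul, one_smul, Finset.sum_add_distrib, sum_perm_zero, zero_add]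

/-- The signature as a linear map. -/
def sigL (π : Equiv.Perm V3) : V3 →ₗ[ZMod 2] V3 where
  toFun := sig π
  map_add' a b := by
    simp only [sig_formula, ← Finset.sum_add_distrib, ← add_smul]
    refine Finset.sum_congr rfl fun y _ => ?_
    simp [dotp, add_mul, Finset.sum_add_distrib]
  map_smul' c a := by
    simp only [sig_formula, Finset.smul_sum, smul_smul, RingHom.id_apply]
    refine Finset.sum_congr rfl fun y _ => ?_
    simp [dotp, mul_assoc, Finset.mul_sum]

theorem line_exists : ∀ x : V3, x ≠ 0 → ∃ y z : V3, y ≠ 0 ∧ z ≠ 0 ∧ y + z ≠ 0 ∧ y ≠ z ∧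
    Finset.univ.filter (fun y => dotp x y = 0) = {0, y, z, y + z} := by
  decide +kernel

theorem v3_add_self (x : V3) : x + x = 0 := CharTwo.add_self_eq_zero x

theorem sigL_injective (π : Equiv.Perm V3) (hπ : Antilinear π) :
    Function.Injective (sigL π) := by
  rw [← LinearMap.ker_eq_bot, LinearMap.ker_eq_bot']
  intro x hx
  by_contra hne
  obtain ⟨y, z, hy, hz, hyz, hne', hf⟩ := line_exists x hne
  have hx' : sig π x = 0 := hx
  unfold sig at hx'
  rw [hf, Finset.sum_insert, Finset.sum_insert, Finset.sum_insert, Finset.sum_singleton,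
    hπ.1, zero_add, ← add_assoc] at hx'
  · rcases hπ.2 y z (y + z) hy hz hyz with h | h
    · exact h (v3_add_self _)
    · exact h hx'
  · simpa using hy
  · simp [hne', hz]
  · simp [hy.symm, hz.symm, hyz.symm]

theorem sig_comp (π φ : Equiv.Perm V3) (L : V3 →ₗ[ZMod 2] V3) (h : ∀ x, π x = L (φ x))
    (x : V3) : sig π x = L (sig φ x) := by
  simp [sig, h]

/-- Every antilinear permutation of `ZZ_2^3` is uniquely of the form `L ∘ φ` with `L` an
invertible linear transformation and `φ` a Fano permutation. -/
theorem stmt11 (π : Equiv.Perm V3) (hπ : Antilinear π) :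
    ∃! p : (V3 →ₗ[ZMod 2] V3) × Equiv.Perm V3,
      Function.Bijective p.1 ∧ Fano p.2 ∧ ∀ x, π x = p.1 (p.2 x) := by
  have hinj := sigL_injective π hπ
  have hbij : Function.Bijective (sigL π) := Finite.injective_iff_bijective.mp hinj
  let e : Equiv.Perm V3 := Equiv.ofBijective _ hbij
  let φ : Equiv.Perm V3 := π.trans e.symm
  have hφ : ∀ x, π x = sigL π (φ x) := fun x => (e.apply_symm_apply (π x)).symm
  refine ⟨(sigL π, φ), ⟨hbij, ⟨⟨?_, ?_⟩, ?_⟩, hφ⟩, ?_⟩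
  · apply hinj
    rw [← hφ, hπ.1, map_zero]
  · intro x y z hx hy hz
    refine (hπ.2 x y z hx hy hz).imp_right fun h h0 => h ?_
    rw [hφ, hφ, hφ, ← map_add, ← map_add, h0, map_zero]
  · intro x
    apply hinj
    exact (sig_comp π φ _ hφ x).symm
  · rintro ⟨L, ψ⟩ ⟨hL, hψ, h⟩
    have hLe : L = sigL π := by
      ext1 x
      ext1
      have := sig_comp π ψ L h
      simp only [hψ.2] at this
      simp [sigL, this]
    subst hLe
    refine Prod.ext rfl ?_
    ext1 x
    apply hinj
    exact (h x).symm.trans (hφ x)
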